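/- arXiv:math/0312390 — 2 statements merged into one kernel-verified Lean document; each statement's English description precedes it below -/
import Mathlib

section
/- Let G₂ be the graph on {1,...,8} with non-edges exactly {1,3}, {2,4}, {5,7}, {6,8}. Then the completion number of G₂ equals 2: every partial positive Hermitian matrix with graph G₂ has a Hermitian completion with at most 2 negative eigenvalues, and there exists a partial positive matrix with graph G₂ every completion of which has at least 2 negative eigenvalues. -/
open Matrix ComplexOrder

/-- Number of positive eigenvalues (with multiplicity) of a Hermitian matrix. -/
noncomputable def posCount {m : Type*} [Fintype m] [DecidableEq m]
    {M : Matrix m m ℂ} (hM : M.IsHermitian) : ℕ :=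
  Fintype.card {i // 0 < hM.eigenvalues i}

/-- Number of negative eigenvalues (with multiplicity) of a Hermitian matrix. -/
noncomputable def negCount {m : Type*} [Fintype m] [DecidableEq m]
    {M : Matrix m m ℂ} (hM : M.IsHermitian) : ℕ :=
  Fintype.card {i // hM.eigenvalues i < 0}

/-- Number of zero eigenvalues (with multiplicity) of a Hermitian matrix. -/
noncomputable def zeroCount {m : Type*} [Fintype m] [DecidableEq m]
    {M : Matrix m m ℂ} (hM : M.IsHermitian) : ℕ :=
  Fintype.card {i // hM.eigenvalues i = 0}

/-- `A` is a partial Hermitian matrix with graph `G`: the diagonal is real and the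
specified (edge) entries are conjugate symmetric.  Non-edge entries of the array `A`
are regarded as unspecified. -/
def IsPartialHermitian {n : ℕ} (G : SimpleGraph (Fin n)) (A : Matrix (Fin n) (Fin n) ℂ) : Prop :=
  (∀ i : Fin n, (A i i).im = 0) ∧ ∀ i j : Fin n, G.Adj i j → A j i = star (A i j)

/-- The principal submatrix of `A` indexed by `K`. -/
def cliqueSub {n : ℕ} (A : Matrix (Fin n) (Fin n) ℂ) (K : Finset (Fin n)) :
    Matrix K K ℂ :=
  A.submatrix (fun i => (i : Fin n)) (fun j => (j : Fin n))

/-- `A` is a partial positive matrix with graph `G`: it is partial Hermitian and every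
fully specified principal submatrix `A(K)`, `K` a clique of `G`, is positive definite. -/
def IsPartialPositive {n : ℕ} (G : SimpleGraph (Fin n)) (A : Matrix (Fin n) (Fin n) ℂ) : Prop :=
  IsPartialHermitian G A ∧
    ∀ K : Finset (Fin n), G.IsClique (K : Set (Fin n)) → (cliqueSub A K).PosDef

/-- The completion number of `G` is `c`: `c` is the least `k` such that every partial
positive matrix with graph `G` has a Hermitian completion with at most `k` negative
eigenvalues. -/
def CompletionNumberIs {n : ℕ} (G : SimpleGraph (Fin n)) (c : ℕ) : Prop :=
  IsLeast {k : ℕ | ∀ A : Matrix (Fin n) (Fin n) ℂ, IsPartialPositive G A →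
    ∃ M : Matrix (Fin n) (Fin n) ℂ, ∃ hM : M.IsHermitian,
      (∀ i j : Fin n, (i = j ∨ G.Adj i j) → M i j = A i j) ∧ negCount hM ≤ k} c

/-- The graph on `{1, …, 8}` (here `Fin 8`, `0`-indexed) whose non-edges are exactly
`{1,3}, {2,4}, {5,7}, {6,8}` (i.e. `{0,2}, {1,3}, {4,6}, {5,7}` in `Fin 8`). -/
def G₂ : SimpleGraph (Fin 8) :=
  (SimpleGraph.fromRel (fun i j =>
    (i = 0 ∧ j = 2) ∨ (i = 1 ∧ j = 3) ∨ (i = 4 ∧ j = 6) ∨ (i = 5 ∧ j = 7)))ᶜ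


def Qf {n : ℕ} (M : Matrix (Fin n) (Fin n) ℂ) (u v : Fin n → ℂ) : ℂ := star u ⬝ᵥ (M *ᵥ v)

lemma Qf_add_right {n : ℕ} (M : Matrix (Fin n) (Fin n) ℂ) (u v w : Fin n → ℂ) :
    Qf M u (v + w) = Qf M u v + Qf M u w := by
  simp [Qf, Matrix.mulVec_add, dotProduct_add]

lemma Qf_sub_right {n : ℕ} (M : Matrix (Fin n) (Fin n) ℂ) (u v w : Fin n → ℂ) :
    Qf M u (v - w) = Qf M u v - Qf M u w := by
  simp [Qf, Matrix.mulVec_sub, dotProduct_sub]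

lemma Qf_smul_right {n : ℕ} (M : Matrix (Fin n) (Fin n) ℂ) (u v : Fin n → ℂ) (c : ℂ) :
    Qf M u (c • v) = c * Qf M u v := by
  simp [Qf, Matrix.mulVec_smul, dotProduct_smul]

lemma Qf_add_left {n : ℕ} (M : Matrix (Fin n) (Fin n) ℂ) (u v w : Fin n → ℂ) :
    Qf M (u + v) w = Qf M u w + Qf M v w := by
  simp [Qf, add_dotProduct]

lemma Qf_smul_left {n : ℕ} (M : Matrix (Fin n) (Fin n) ℂ) (u v : Fin n → ℂ) (c : ℂ) :
    Qf M (c • u) v = star c * Qf M u v := by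
  simp [Qf, smul_dotProduct, star_smul]

lemma Qf_symm {n : ℕ} {M : Matrix (Fin n) (Fin n) ℂ} (hM : M.IsHermitian) (u v : Fin n → ℂ) :
    star (Qf M u v) = Qf M v u := by
  unfold Qf
  rw [Matrix.star_dotProduct, star_star, Matrix.star_mulVec, hM.eq, Matrix.dotProduct_mulVec]

lemma Qf_zero_right {n : ℕ} (M : Matrix (Fin n) (Fin n) ℂ) (u : Fin n → ℂ) :
    Qf M u 0 = 0 := by simp [Qf]

lemma Qf_eq_sum {n : ℕ} (M : Matrix (Fin n) (Fin n) ℂ) (u v : Fin n → ℂ) :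
    Qf M u v = ∑ i, ∑ j, star (u i) * M i j * v j := by
  simp [Qf, dotProduct, Matrix.mulVec, Finset.mul_sum, mul_assoc]

lemma Qf_congr {n : ℕ} {M N : Matrix (Fin n) (Fin n) ℂ} {S : Finset (Fin n)}
    (h : ∀ i ∈ S, ∀ j ∈ S, M i j = N i j) {u v : Fin n → ℂ}
    (hu : ∀ i, i ∉ S → u i = 0) (hv : ∀ i, i ∉ S → v i = 0) : Qf M u v = Qf N u v := by
  rw [Qf_eq_sum, Qf_eq_sum]
  refine Finset.sum_congr rfl fun i _ => Finset.sum_congr rfl fun j _ => ?_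
  by_cases hi : i ∈ S
  · by_cases hj : j ∈ S
    · rw [h i hi j hj]
    · simp [hv j hj]
  · simp [hu i hi]

def PD {n : ℕ} (M : Matrix (Fin n) (Fin n) ℂ) (W : Submodule ℂ (Fin n → ℂ)) : Prop :=
  ∀ w ∈ W, w ≠ 0 → 0 < (Qf M w w).re

def PI {n : ℕ} (M : Matrix (Fin n) (Fin n) ℂ) (S : Finset (Fin n)) (d : ℕ) : Prop :=
  ∃ W : Submodule ℂ (Fin n → ℂ), d ≤ Module.finrank ℂ W ∧
    (∀ w ∈ W, ∀ i, i ∉ S → w i = 0) ∧ PD M W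

lemma PI.mono {n : ℕ} {M : Matrix (Fin n) (Fin n) ℂ} {S T : Finset (Fin n)} {d : ℕ}
    (h : PI M S d) (hST : S ⊆ T) : PI M T d := by
  obtain ⟨W, h1, h2, h3⟩ := h
  exact ⟨W, h1, fun w hw i hi => h2 w hw i (fun h => hi (hST h)), h3⟩

lemma PI.congr {n : ℕ} {M N : Matrix (Fin n) (Fin n) ℂ} {S : Finset (Fin n)} {d : ℕ}
    (h : PI M S d) (hMN : ∀ i ∈ S, ∀ j ∈ S, M i j = N i j) : PI N S d := by
  obtain ⟨W, h1, h2, h3⟩ := h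
  refine ⟨W, h1, h2, fun w hw hw0 => ?_⟩
  rw [← Qf_congr hMN (h2 w hw) (h2 w hw)]
  exact h3 w hw hw0

lemma PD_add {n : ℕ} {M : Matrix (Fin n) (Fin n) ℂ} (hM : M.IsHermitian)
    {W : Submodule ℂ (Fin n → ℂ)} (hW : PD M W) {u : Fin n → ℂ}
    (hu : ∀ w ∈ W, Qf M w u = 0) (hpos : 0 < (Qf M u u).re) :
    PD M (W ⊔ Submodule.span ℂ {u}) ∧
      Module.finrank ℂ W + 1 ≤ Module.finrank ℂ ↥(W ⊔ Submodule.span ℂ {u}) := by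
  constructor
  · intro w hw hw0
    obtain ⟨y, hy, z, hz, rfl⟩ := Submodule.mem_sup.1 hw
    obtain ⟨c, rfl⟩ := Submodule.mem_span_singleton.1 hz
    have h1 : Qf M u y = 0 := by rw [← Qf_symm hM, hu y hy, star_zero]
    have : Qf M (y + c • u) (y + c • u) = Qf M y y + (Complex.normSq c : ℂ) * Qf M u u := by
      rw [Qf_add_left, Qf_add_right, Qf_add_right, Qf_smul_left, Qf_smul_left, Qf_smul_right,
        Qf_smul_right, hu y hy, h1, Complex.normSq_eq_conj_mul_self]
      simp only [starRingEnd_apply]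
      ring
    rw [this, Complex.add_re, Complex.re_ofReal_mul]
    by_cases hy0 : y = 0
    · subst hy0
      have hc : c ≠ 0 := by rintro rfl; simp at hw0
      have := Complex.normSq_pos.2 hc
      rw [Qf_zero_right]
      simp only [Complex.zero_re, zero_add]
      positivity
    · have := hW y hy hy0
      have := Complex.normSq_nonneg c
      positivity
  · have hlt : W < W ⊔ Submodule.span ℂ {u} := by
      refine lt_of_le_of_ne le_sup_left fun h => ?_
      have : u ∈ W := by
        rw [h]; exact Submodule.mem_sup_right (Submodule.mem_span_singleton_self u)
      rw [hu u this] at hpos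
      simp at hpos
    exact Submodule.finrank_lt_finrank_of_lt hlt

/-- orthogonality functional map -/
noncomputable def orthMap {n : ℕ} (M : Matrix (Fin n) (Fin n) ℂ) (W : Submodule ℂ (Fin n → ℂ)) :
    (Fin n → ℂ) →ₗ[ℂ] (Fin (Module.finrank ℂ W) → ℂ) where
  toFun v := fun i => Qf M ((Module.finBasis ℂ W i : W) : Fin n → ℂ) v
  map_add' u v := by ext i; simp [Qf_add_right]
  map_smul' c v := by ext i; simp [Qf_smul_right]

lemma orthMap_eq_zero {n : ℕ} {M : Matrix (Fin n) (Fin n) ℂ} {W : Submodule ℂ (Fin n → ℂ)}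
    {v : Fin n → ℂ} (h : orthMap M W v = 0) : ∀ w ∈ W, Qf M w v = 0 := by
  intro w hw
  have h1 := (Module.finBasis ℂ W).sum_repr ⟨w, hw⟩
  have h2 : w = ∑ i, (Module.finBasis ℂ W).repr ⟨w, hw⟩ i •
      ((Module.finBasis ℂ W i : W) : Fin n → ℂ) := by
    have := congrArg (W.subtype) h1
    rw [map_sum] at this
    exact this.symm
  have h3 : ∀ i, Qf M ((Module.finBasis ℂ W i : W) : Fin n → ℂ) v = 0 := fun i => congrFun h i
  rw [h2]
  unfold Qf at *
  rw [star_sum, sum_dotProduct]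
  refine Finset.sum_eq_zero fun i _ => ?_
  rw [star_smul, smul_dotProduct, h3 i, smul_zero]

lemma exists_proj {n : ℕ} {M : Matrix (Fin n) (Fin n) ℂ}
    {W : Submodule ℂ (Fin n → ℂ)} (hW : PD M W) (v : Fin n → ℂ) :
    ∃ w ∈ W, ∀ z ∈ W, Qf M z (v - w) = 0 := by
  have hinj : Function.Injective ((orthMap M W).comp W.subtype) := by
    rw [← LinearMap.ker_eq_bot, LinearMap.ker_eq_bot']
    intro w hw
    by_contra hne
    have := orthMap_eq_zero (v := (w : Fin n → ℂ)) hw w w.2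
    have h2 := hW w w.2 (by simpa using hne)
    rw [this] at h2; simp at h2
  have hsurj := (LinearMap.injective_iff_surjective_of_finrank_eq_finrank (by simp)).1 hinj
  obtain ⟨w, hw⟩ := hsurj (orthMap M W v)
  refine ⟨w, w.2, orthMap_eq_zero ?_⟩
  rw [map_sub, sub_eq_zero]
  exact hw.symm

lemma exists_orth {n : ℕ} {M : Matrix (Fin n) (Fin n) ℂ}
    {W V : Submodule ℂ (Fin n → ℂ)} (h : Module.finrank ℂ W < Module.finrank ℂ V) :
    ∃ v ∈ V, v ≠ 0 ∧ ∀ z ∈ W, Qf M z v = 0 := by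
  have := LinearMap.ker_ne_bot_of_finrank_lt (f := (orthMap M W).comp V.subtype) (by simpa using h)
  obtain ⟨v, hv, hv0⟩ := Submodule.exists_mem_ne_zero_of_ne_bot this
  exact ⟨v, v.2, by simpa using hv0, orthMap_eq_zero hv⟩

lemma exists_sep {n : ℕ} {M : Matrix (Fin n) (Fin n) ℂ} (hM : M.IsHermitian)
    {R : Finset (Fin n)} {b : Fin n} {d : ℕ}
    {W : Submodule ℂ (Fin n → ℂ)} (hW : PD M W) (hWR : ∀ w ∈ W, ∀ i, i ∉ R → w i = 0)
    (hWd : Module.finrank ℂ W + 1 = d) (hR : ¬ PI M R d) (hb : PI M (insert b R) d) :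
    ∃ u : Fin n → ℂ, (∀ i, i ∉ insert b R → u i = 0) ∧ u b = 1 ∧ (∀ w ∈ W, Qf M w u = 0) ∧
      0 < (Qf M u u).re := by
  obtain ⟨V, hV1, hV2, hV3⟩ := hb
  obtain ⟨v, hv, hv0, hvo⟩ := exists_orth (M := M) (W := W) (V := V) (by omega)
  have hpos := hV3 v hv hv0
  have hvb : v b ≠ 0 := by
    intro hvb
    apply hR
    obtain ⟨h1, h2⟩ := PD_add hM hW hvo hpos
    refine ⟨_, by omega, ?_, h1⟩
    intro w hw i hi
    obtain ⟨y, hy, z, hz, rfl⟩ := Submodule.mem_sup.1 hw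
    obtain ⟨c, rfl⟩ := Submodule.mem_span_singleton.1 hz
    have : v i = 0 := by
      by_cases hib : i = b
      · rw [hib, hvb]
      · exact hV2 v hv i (by simp [hib, hi])
    simp [hWR y hy i hi, this]
  have hu : (v b)⁻¹ • v ∈ V := V.smul_mem _ hv
  refine ⟨(v b)⁻¹ • v, hV2 _ hu, by simp [hvb], ?_, hV3 _ hu ?_⟩
  · intro w hw
    rw [Qf_smul_right, hvo w hw, mul_zero]
  · exact smul_ne_zero (inv_ne_zero hvb) hv0

def upd {n : ℕ} (M : Matrix (Fin n) (Fin n) ℂ) (a b : Fin n) (x : ℂ) :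
    Matrix (Fin n) (Fin n) ℂ := M + (Matrix.single a b x + Matrix.single b a (star x))

lemma upd_herm {n : ℕ} {M : Matrix (Fin n) (Fin n) ℂ} (hM : M.IsHermitian) (a b : Fin n) (x : ℂ) :
    (upd M a b x).IsHermitian := by
  unfold upd
  refine hM.add ?_
  unfold Matrix.IsHermitian
  rw [Matrix.conjTranspose_add, Matrix.conjTranspose_single, Matrix.conjTranspose_single, star_star,
    add_comm]

lemma upd_apply {n : ℕ} (M : Matrix (Fin n) (Fin n) ℂ) {a b : Fin n} (x : ℂ) {i j : Fin n}
    (h1 : ¬ (i = a ∧ j = b)) (h2 : ¬ (i = b ∧ j = a)) : upd M a b x i j = M i j := by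
  unfold upd
  rw [Matrix.add_apply, Matrix.add_apply, Matrix.single_apply_of_ne, Matrix.single_apply_of_ne]
  · simp
  · tauto
  · tauto

lemma Qf_upd {n : ℕ} (M : Matrix (Fin n) (Fin n) ℂ) (a b : Fin n) (x : ℂ) (u v : Fin n → ℂ) :
    Qf (upd M a b x) u v = Qf M u v + star (u a) * x * v b + star (u b) * star x * v a := by
  unfold upd Qf
  rw [Matrix.add_mulVec, Matrix.add_mulVec, dotProduct_add, dotProduct_add, Matrix.single_mulVec,
    Matrix.single_mulVec]
  simp [Function.update_apply, dotProduct]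
  ring

set_option maxHeartbeats 2000000 in
lemma onestep {n : ℕ} {M : Matrix (Fin n) (Fin n) ℂ} (hM : M.IsHermitian)
    {R : Finset (Fin n)} {a b : Fin n} {d : ℕ} (hab : a ≠ b) (ha : a ∉ R) (hb : b ∉ R)
    (hA : PI M (insert a R) d) (hB : PI M (insert b R) d) :
    ∃ x, PI (upd M a b x) (insert a (insert b R)) (d + 1) := by
  by_cases hR : PI M R d
  · obtain ⟨W, h1, h2, h3⟩ := hR
    obtain ⟨w, hw, ho⟩ := exists_proj h3 (Pi.single a 1 + Pi.single b 1)
    set u : Fin n → ℂ := Pi.single a 1 + Pi.single b 1 - w with hu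
    have hua : u a = 1 := by simp [hu, h2 w hw a ha, hab]
    have hub : u b = 1 := by simp [hu, h2 w hw b hb, hab.symm]
    refine ⟨(((1 - (Qf M u u).re) / 2 : ℝ) : ℂ), ?_⟩
    set x : ℂ := (((1 - (Qf M u u).re) / 2 : ℝ) : ℂ) with hx
    have hW' : PD (upd M a b x) W := by
      intro z hz hz0
      rw [Qf_upd, h2 z hz a ha, h2 z hz b hb]
      simpa using h3 z hz hz0
    obtain ⟨k1, k2⟩ := PD_add (upd_herm hM a b x) hW' (u := u) (by
      intro z hz
      rw [Qf_upd, h2 z hz a ha, h2 z hz b hb, ho z hz]; simp) (by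
      rw [Qf_upd, hua, hub]
      simp [hx]
      linarith)
    refine ⟨_, by omega, ?_, k1⟩
    intro z hz i hi
    obtain ⟨y, hy, z, hz1, rfl⟩ := Submodule.mem_sup.1 hz
    obtain ⟨c, rfl⟩ := Submodule.mem_span_singleton.1 hz1
    simp only [Finset.mem_insert, not_or] at hi
    have hui : u i = 0 := by
      rw [hu]
      simp [h2 w hw i hi.2.2, hi.1, hi.2.1]
    rw [Pi.add_apply, Pi.smul_apply, hui, h2 y hy i hi.2.2]
    simp
  · have hA' := hA
    obtain ⟨V, hV1, hV2, hV3⟩ := hA'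
    let W : Submodule ℂ (Fin n → ℂ) := V ⊓ LinearMap.ker (LinearMap.proj (R := ℂ) (φ := fun _ : Fin n => ℂ) a)
    have hWR : ∀ w ∈ W, ∀ i, i ∉ R → w i = 0 := by
      intro w hw i hi
      by_cases hia : i = a
      · subst hia; exact hw.2
      · exact hV2 w hw.1 i (by simp [hia, hi])
    have hWP : PD M W := fun w hw => hV3 w hw.1
    have hlt : Module.finrank ℂ W < d := by
      by_contra h
      exact hR ⟨W, by omega, hWR, hWP⟩
    have hge : Module.finrank ℂ V ≤ Module.finrank ℂ W + 1 := by
      have e1 := Submodule.finrank_sup_add_finrank_inf_eq V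
        (LinearMap.ker (LinearMap.proj (R := ℂ) (φ := fun _ : Fin n => ℂ) a))
      have e2 := LinearMap.finrank_range_add_finrank_ker
        (LinearMap.proj (R := ℂ) (φ := fun _ : Fin n => ℂ) a)
      have e3 := Submodule.finrank_le (V ⊔ LinearMap.ker (LinearMap.proj (R := ℂ) (φ := fun _ : Fin n => ℂ) a))
      have e4 := Submodule.finrank_le (LinearMap.range (LinearMap.proj (R := ℂ) (φ := fun _ : Fin n => ℂ) a))
      rw [Module.finrank_self] at e4
      change Module.finrank ℂ V ≤ Module.finrank ℂ ↥(V ⊓ LinearMap.ker (LinearMap.proj (R := ℂ) (φ := fun _ : Fin n => ℂ) a)) + 1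
      omega
    obtain ⟨u, u1, u2, u3, u4⟩ := exists_sep hM hWP hWR (by omega) hR hA
    obtain ⟨v, v1, v2, v3, v4⟩ := exists_sep hM hWP hWR (by omega) hR hB
    have hub : u b = 0 := u1 b (by simp [hab.symm, hb])
    have hva : v a = 0 := v1 a (by simp [hab, ha])
    refine ⟨-(Qf M u v), ?_⟩
    set x := -(Qf M u v) with hx
    have hH := upd_herm hM a b x
    have hW' : PD (upd M a b x) W := by
      intro z hz hz0
      rw [Qf_upd, hWR z hz a ha, hWR z hz b hb]
      simpa using hWP z hz hz0
    obtain ⟨k1, k2⟩ := PD_add hH hW' (u := u) (by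
      intro z hz
      rw [Qf_upd, hWR z hz a ha, hWR z hz b hb, u3 z hz]; simp) (by
      rw [Qf_upd, hub]; simpa using u4)
    obtain ⟨l1, l2⟩ := PD_add hH k1 (u := v) (by
      intro z hz
      obtain ⟨y, hy, z, hz1, rfl⟩ := Submodule.mem_sup.1 hz
      obtain ⟨c, rfl⟩ := Submodule.mem_span_singleton.1 hz1
      rw [Qf_add_left, Qf_smul_left, Qf_upd, Qf_upd, hWR y hy a ha, hWR y hy b hb, v3 y hy, hub,
        u2, v2]
      simp [hx]) (by
      rw [Qf_upd, hva]; simpa using v4)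
    refine ⟨_, by omega, ?_, l1⟩
    intro z hz i hi
    simp only [Finset.mem_insert, not_or] at hi
    obtain ⟨y', hy', z, hz1, rfl⟩ := Submodule.mem_sup.1 hz
    obtain ⟨c, rfl⟩ := Submodule.mem_span_singleton.1 hz1
    obtain ⟨y, hy, z', hz', rfl⟩ := Submodule.mem_sup.1 hy'
    obtain ⟨c', rfl⟩ := Submodule.mem_span_singleton.1 hz'
    simp [hWR y hy i hi.2.2, u1 i (by simp [hi]), v1 i (by simp [hi])]

lemma eig_bound {n : ℕ} {M : Matrix (Fin n) (Fin n) ℂ} (hM : M.IsHermitian) (σ : ℝ)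
    (W : Submodule ℂ (Fin n → ℂ)) (hW : ∀ w ∈ W, w ≠ 0 → 0 < σ * (Qf M w w).re) :
    Module.finrank ℂ W ≤ Fintype.card {i // 0 < σ * hM.eigenvalues i} := by
  by_contra hlt
  push Not at hlt
  let U : Matrix (Fin n) (Fin n) ℂ := hM.eigenvectorUnitary
  let f : W →ₗ[ℂ] ({i // 0 < σ * hM.eigenvalues i} → ℂ) :=
    (LinearMap.funLeft ℂ ℂ Subtype.val).comp ((Matrix.mulVecLin Uᴴ).comp W.subtype)
  have := LinearMap.ker_ne_bot_of_finrank_lt (f := f) (by simpa using hlt)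
  obtain ⟨v, hv, hv0⟩ := Submodule.exists_mem_ne_zero_of_ne_bot this
  have hp := hW v v.2 (by simpa using hv0)
  set c := Uᴴ *ᵥ (v : Fin n → ℂ) with hc
  have hc0 : ∀ i, 0 < σ * hM.eigenvalues i → c i = 0 := fun i hi => congrFun hv ⟨i, hi⟩
  have hQ : Qf M v v = ∑ i, ((hM.eigenvalues i * Complex.normSq (c i) : ℝ) : ℂ) := by
    have hs := hM.spectral_theorem
    have hs' : M = U * Matrix.diagonal (RCLike.ofReal ∘ hM.eigenvalues) * Uᴴ := by
      simpa [U, Unitary.conjStarAlgAut_apply, Matrix.star_eq_conjTranspose] using hs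
    unfold Qf
    conv_lhs => rw [hs']
    rw [← Matrix.mulVec_mulVec, ← hc, ← Matrix.mulVec_mulVec, Matrix.dotProduct_mulVec]
    have : star (v : Fin n → ℂ) ᵥ* U = star c := by
      rw [hc, Matrix.star_mulVec, Matrix.conjTranspose_conjTranspose]
    rw [this]
    simp only [dotProduct, Matrix.mulVec_diagonal, Pi.star_apply, Function.comp]
    refine Finset.sum_congr rfl fun i _ => ?_
    push_cast
    rw [Complex.normSq_eq_conj_mul_self]
    simp
    ring
  rw [hQ, ← Complex.ofReal_sum, Complex.ofReal_re, Finset.mul_sum] at hp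
  refine absurd hp (not_lt.2 (Finset.sum_nonpos fun i _ => ?_))
  by_cases hi : 0 < σ * hM.eigenvalues i
  · simp [hc0 i hi]
  · have := Complex.normSq_nonneg (c i)
    push Not at hi
    rw [← mul_assoc]
    exact mul_nonpos_of_nonpos_of_nonneg hi this

lemma clique_PI {n : ℕ} {A M : Matrix (Fin n) (Fin n) ℂ} {K : Finset (Fin n)}
    (hK : (cliqueSub A K).PosDef) (h : ∀ i ∈ K, ∀ j ∈ K, M i j = A i j) : PI M K K.card := by
  let f : (K → ℂ) →ₗ[ℂ] (Fin n → ℂ) :=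
    { toFun := fun v i => if hi : i ∈ K then v ⟨i, hi⟩ else 0
      map_add' := by intro u v; ext i; by_cases hi : i ∈ K <;> simp [hi]
      map_smul' := by intro u v; ext i; by_cases hi : i ∈ K <;> simp [hi] }
  have hf1 : ∀ v (i : K), f v i = v i := fun v i => by simp [f]
  have hf0 : ∀ v i, i ∉ K → f v i = 0 := fun v i hi => by simp [f, hi]
  have hinj : Function.Injective f := by
    intro u v huv
    ext i
    rw [← hf1 u, huv, hf1]
  refine ⟨LinearMap.range f, ?_, ?_, ?_⟩
  · rw [LinearMap.finrank_range_of_inj hinj]; simp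
  · rintro _ ⟨v, rfl⟩ i hi
    exact hf0 v i hi
  · rintro _ ⟨v, rfl⟩ hv
    have hv0 : v ≠ 0 := by rintro rfl; simp at hv
    have := hK.dotProduct_mulVec_pos hv0
    have e : Qf M (f v) (f v) = star v ⬝ᵥ (cliqueSub A K *ᵥ v) := by
      rw [Qf_eq_sum]
      simp only [dotProduct, Matrix.mulVec, Finset.mul_sum]
      have key : ∀ g : Fin n → ℂ, (∀ i, i ∉ K → g i = 0) → ∑ i, g i = ∑ i : K, g i := by
        intro g hg
        rw [Finset.sum_coe_sort K g]
        exact (Finset.sum_subset (Finset.subset_univ K) (fun i _ hi => hg i hi)).symm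
      rw [key _ (fun i hi => by simp [hf0 v i hi])]
      refine Finset.sum_congr rfl fun i _ => ?_
      rw [key _ (fun i hi => by simp [hf0 v i hi])]
      refine Finset.sum_congr rfl fun j _ => ?_
      rw [hf1, hf1, h i i.2 j j.2]
      simp [cliqueSub, mul_assoc]
    rw [e]
    exact (Complex.lt_def.1 this).1

lemma G₂_adj (i j : Fin 8) : G₂.Adj i j ↔ i ≠ j ∧ ¬ (
    (i = 0 ∧ j = 2) ∨ (i = 1 ∧ j = 3) ∨ (i = 4 ∧ j = 6) ∨ (i = 5 ∧ j = 7) ∨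
    (j = 0 ∧ i = 2) ∨ (j = 1 ∧ i = 3) ∨ (j = 4 ∧ i = 6) ∨ (j = 5 ∧ i = 7)) := by
  unfold G₂
  rw [SimpleGraph.compl_adj, SimpleGraph.fromRel_adj]
  grind

instance : DecidableRel G₂.Adj := fun i j => decidable_of_iff _ (G₂_adj i j).symm

lemma upper (A : Matrix (Fin 8) (Fin 8) ℂ) (hA : IsPartialPositive G₂ A) :
    ∃ M : Matrix (Fin 8) (Fin 8) ℂ, ∃ hM : M.IsHermitian,
      (∀ i j : Fin 8, (i = j ∨ G₂.Adj i j) → M i j = A i j) ∧ negCount hM ≤ 2 := by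
  let M₀ : Matrix (Fin 8) (Fin 8) ℂ := Matrix.of fun i j => if i = j ∨ G₂.Adj i j then A i j else 0
  have hM₀ : M₀.IsHermitian := by
    ext i j
    simp only [Matrix.conjTranspose_apply, M₀, Matrix.of_apply]
    by_cases hij : i = j
    · subst hij
      simp only [true_or, if_true]
      exact Complex.conj_eq_iff_im.2 (hA.1.1 i)
    · by_cases h : G₂.Adj i j
      · simp only [h, h.symm, or_true, if_true]
        rw [hA.1.2 i j h, star_star]
      · have h' : ¬ G₂.Adj j i := fun k => h k.symm
        simp [hij, Ne.symm hij, h, h']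
  have hM₀A : ∀ i j, (i = j ∨ G₂.Adj i j) → M₀ i j = A i j := fun i j h => by simp only [M₀, Matrix.of_apply, if_pos h]
  have hcl : ∀ K : Finset (Fin 8), (∀ i ∈ K, ∀ j ∈ K, i = j ∨ G₂.Adj i j) → PI M₀ K K.card := by
    intro K hK
    refine clique_PI (hA.2 K ?_) (fun i hi j hj => hM₀A i j (hK i hi j hj))
    intro i hi j hj hij
    exact (hK i hi j hj).resolve_left hij
  -- step 1
  obtain ⟨x1, p1⟩ := onestep hM₀ (R := {1, 4}) (a := 0) (b := 2) (d := 3) (by decide) (by decide)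
    (by decide) (hcl {0, 1, 4} (by decide)) (hcl {2, 1, 4} (by decide))
  have hM1 := upd_herm hM₀ 0 2 x1
  have e1 : ∀ i j, ¬ (i = 0 ∧ j = 2) → ¬ (i = 2 ∧ j = 0) → upd M₀ 0 2 x1 i j = M₀ i j :=
    fun i j => upd_apply M₀ x1
  generalize upd M₀ 0 2 x1 = M1 at p1 hM1 e1
  -- step 2
  have q1 : PI M1 {0, 1, 6} 3 := (hcl {0, 1, 6} (by decide)).congr (by
    intro i hi j hj
    exact (e1 i j (by revert i j; decide) (by revert i j; decide)).symm)
  have q2 : PI M1 {0, 3, 6} 3 := (hcl {0, 3, 6} (by decide)).congr (by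
    intro i hi j hj
    exact (e1 i j (by revert i j; decide) (by revert i j; decide)).symm)
  obtain ⟨x2, p2⟩ := onestep hM1 (R := {0, 2, 6}) (a := 1) (b := 3) (d := 3) (by decide) (by decide)
    (by decide) (q1.mono (by decide)) (q2.mono (by decide))
  have hM2 := upd_herm hM1 1 3 x2
  have e2 : ∀ i j, ¬ (i = 1 ∧ j = 3) → ¬ (i = 3 ∧ j = 1) → upd M1 1 3 x2 i j = M1 i j :=
    fun i j => upd_apply M1 x2
  generalize upd M1 1 3 x2 = M2 at p2 hM2 e2
  -- step 3
  have q3 : PI M2 {0, 2, 1, 4} 4 := p1.congr (by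
    intro i hi j hj
    exact (e2 i j (by revert i j; decide) (by revert i j; decide)).symm)
  obtain ⟨x3, p3⟩ := onestep hM2 (R := {0, 1, 2, 3}) (a := 4) (b := 6) (d := 4) (by decide)
    (by decide) (by decide) (q3.mono (by decide)) (p2.mono (by decide))
  have hM3 := upd_herm hM2 4 6 x3
  have e3 : ∀ i j, ¬ (i = 4 ∧ j = 6) → ¬ (i = 6 ∧ j = 4) → upd M2 4 6 x3 i j = M2 i j :=
    fun i j => upd_apply M2 x3
  generalize upd M2 4 6 x3 = M3 at p3 hM3 e3
  -- step 4
  obtain ⟨x4, p4⟩ := onestep hM3 (R := {0, 1, 2, 3, 4, 6}) (a := 5) (b := 7) (d := 5) (by decide)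
    (by decide) (by decide) (p3.mono (by decide)) (p3.mono (by decide))
  have hM4 := upd_herm hM3 5 7 x4
  have e4 : ∀ i j, ¬ (i = 5 ∧ j = 7) → ¬ (i = 7 ∧ j = 5) → upd M3 5 7 x4 i j = M3 i j :=
    fun i j => upd_apply M3 x4
  generalize upd M3 5 7 x4 = M4 at p4 hM4 e4
  refine ⟨M4, hM4, ?_, ?_⟩
  · intro i j hij
    rw [← hM₀A i j hij, e4, e3, e2, e1] <;> (revert i j; decide)
  · obtain ⟨W, h1, -, h3⟩ := p4
    have := eig_bound hM4 1 W (by simpa [PD] using h3)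
    unfold negCount
    have h8 : Fintype.card {i // 0 < 1 * hM4.eigenvalues i} +
        Fintype.card {i // hM4.eigenvalues i < 0} ≤ 8 := by
      rw [← Fintype.card_subtype_or_disjoint]
      · exact (Fintype.card_subtype_le _).trans (by simp)
      · rw [Pi.disjoint_iff]
        intro i
        simp only [Prop.disjoint_iff]
        rw [one_mul]
        grind
    omega

noncomputable def Bad : Matrix (Fin 8) (Fin 8) ℂ :=
  !![1, 4/5, 0, -4/5, 0, 0, 0, 0;
     4/5, 1, 4/5, 0, 0, 0, 0, 0;
     0, 4/5, 1, 4/5, 0, 0, 0, 0;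
     -4/5, 0, 4/5, 1, 0, 0, 0, 0;
     0, 0, 0, 0, 1, 4/5, 0, -4/5;
     0, 0, 0, 0, 4/5, 1, 4/5, 0;
     0, 0, 0, 0, 0, 4/5, 1, 4/5;
     0, 0, 0, 0, -4/5, 0, 4/5, 1]

lemma Bad_herm : Bad.IsHermitian := by
  ext i j
  fin_cases i <;> fin_cases j <;> simp [Bad]

lemma blk (a b c d e f g h : ℝ) (h1 : (a = 0 ∧ b = 0) ∨ (e = 0 ∧ f = 0))
    (h2 : (c = 0 ∧ d = 0) ∨ (g = 0 ∧ h = 0)) :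
    (a^2+b^2+c^2+d^2+e^2+f^2+g^2+h^2) / 5 ≤ a^2+b^2+c^2+d^2+e^2+f^2+g^2+h^2
      + 8/5 * (a*c+b*d+c*e+d*f+e*g+f*h-g*a-h*b) := by
  rcases h1 with ⟨p, q⟩ | ⟨p, q⟩ <;> rcases h2 with ⟨r, s⟩ | ⟨r, s⟩ <;> rw [p, q, r, s] <;>
  nlinarith [sq_nonneg (e+g), sq_nonneg (f+h), sq_nonneg (c+e), sq_nonneg (d+f), sq_nonneg (a-g),
    sq_nonneg (b-h), sq_nonneg (a+c), sq_nonneg (b+d)]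

lemma Bad_form (v : Fin 8 → ℂ) : (Qf Bad v v).re =
    ((v 0).re^2+(v 0).im^2+(v 1).re^2+(v 1).im^2+(v 2).re^2+(v 2).im^2+(v 3).re^2+(v 3).im^2
      + 8/5 * ((v 0).re*(v 1).re+(v 0).im*(v 1).im+(v 1).re*(v 2).re+(v 1).im*(v 2).im
        +(v 2).re*(v 3).re+(v 2).im*(v 3).im-(v 3).re*(v 0).re-(v 3).im*(v 0).im)) +
    ((v 4).re^2+(v 4).im^2+(v 5).re^2+(v 5).im^2+(v 6).re^2+(v 6).im^2+(v 7).re^2+(v 7).im^2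
      + 8/5 * ((v 4).re*(v 5).re+(v 4).im*(v 5).im+(v 5).re*(v 6).re+(v 5).im*(v 6).im
        +(v 6).re*(v 7).re+(v 6).im*(v 7).im-(v 7).re*(v 4).re-(v 7).im*(v 4).im)) := by
  have h45 : ((4:ℂ)/5) = (((4/5 : ℝ)) : ℂ) := by push_cast; rfl
  have h45' : (-(4:ℂ)/5) = (((-4/5 : ℝ)) : ℂ) := by push_cast; rfl
  rw [Qf_eq_sum]
  simp only [Fin.sum_univ_eight, Bad, h45, h45']
  simp [-Complex.ofReal_div, -Complex.ofReal_neg, Complex.add_re, Complex.mul_re, Complex.mul_im]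
  ring

lemma Bad_pp : IsPartialPositive G₂ Bad := by
  refine ⟨⟨?_, fun i j _ => (Bad_herm.apply j i).symm⟩, ?_⟩
  · intro i
    have := Bad_herm.apply i i
    exact Complex.conj_eq_iff_im.1 this
  · intro K hK
    refine Matrix.PosDef.of_dotProduct_mulVec_pos (Bad_herm.submatrix _) ?_
    intro v hv
    let w : Fin 8 → ℂ := fun i => if hi : i ∈ K then v ⟨i, hi⟩ else 0
    have hw1 : ∀ i : K, w i = v i := fun i => by simp [w]
    have hw0 : ∀ i, i ∉ K → w i = 0 := fun i hi => by simp [w, hi]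
    have e : Qf Bad w w = star v ⬝ᵥ (cliqueSub Bad K *ᵥ v) := by
      rw [Qf_eq_sum]
      simp only [dotProduct, Matrix.mulVec, Finset.mul_sum]
      have key : ∀ g : Fin 8 → ℂ, (∀ i, i ∉ K → g i = 0) → ∑ i, g i = ∑ i : K, g i := by
        intro g hg
        rw [Finset.sum_coe_sort K g]
        exact (Finset.sum_subset (Finset.subset_univ K) (fun i _ hi => hg i hi)).symm
      rw [key _ (fun i hi => by simp [hw0 i hi])]
      refine Finset.sum_congr rfl fun i _ => ?_
      rw [key _ (fun i hi => by simp [hw0 i hi])]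
      refine Finset.sum_congr rfl fun j _ => ?_
      rw [hw1, hw1]
      simp [cliqueSub, mul_assoc]
    change 0 < star v ⬝ᵥ (cliqueSub Bad K *ᵥ v)
    rw [← e, Complex.lt_def]
    have him : (Qf Bad w w).im = 0 := Complex.conj_eq_iff_im.1 (Qf_symm Bad_herm w w)
    refine ⟨?_, by simp [him]⟩
    have hne : ∀ i j, ¬ G₂.Adj i j → i ≠ j → ((w i).re = 0 ∧ (w i).im = 0) ∨ ((w j).re = 0 ∧ (w j).im = 0) := by
      intro i j hij hne
      by_cases hi : i ∈ K
      · by_cases hj : j ∈ K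
        · exact absurd (hK hi hj hne) hij
        · right; simp [hw0 j hj]
      · left; simp [hw0 i hi]
    have b1 := blk _ _ _ _ _ _ _ _ (hne 0 2 (by decide) (by decide)) (hne 1 3 (by decide) (by decide))
    have b2 := blk _ _ _ _ _ _ _ _ (hne 4 6 (by decide) (by decide)) (hne 5 7 (by decide) (by decide))
    rw [Bad_form, Complex.zero_re]
    refine lt_of_lt_of_le ?_ (add_le_add b1 b2)
    obtain ⟨i, hi⟩ : ∃ i, w i ≠ 0 := by
      by_contra h
      push Not at h
      exact hv (by ext i; rw [← hw1, h]; rfl)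
    have hn := Complex.normSq_pos.2 hi
    rw [Complex.normSq_apply] at hn
    have : (∑ i, ((w i).re^2 + (w i).im^2)) / 5 > 0 := by
      refine div_pos (Finset.sum_pos' (fun i _ => by positivity) ⟨i, Finset.mem_univ _, by nlinarith⟩) (by norm_num)
    rw [Fin.sum_univ_eight] at this
    linarith

lemma neg_vec (M : Matrix (Fin 8) (Fin 8) ℂ) (p q r s : Fin 8) (hpq : [p, q, r, s].Nodup)
    (h00 : M p p = 1) (h11 : M q q = 1) (h22 : M r r = 1) (h33 : M s s = 1)
    (h01 : M p q = 4/5) (h10 : M q p = 4/5) (h12 : M q r = 4/5) (h21 : M r q = 4/5)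
    (h23 : M r s = 4/5) (h32 : M s r = 4/5) (h30 : M s p = -4/5) (h03 : M p s = -4/5) :
    ∃ v : Fin 8 → ℂ, (∀ i, i ∉ ({p, q, r, s} : Finset (Fin 8)) → v i = 0) ∧ (Qf M v v).re < 0 := by
  let V : ℂ → ℂ → ℂ → ℂ → Fin 8 → ℂ := fun a b c d =>
    Pi.single p a + Pi.single q b + Pi.single r c + Pi.single s d
  have hV : ∀ a b c d i, i ∉ ({p, q, r, s} : Finset (Fin 8)) → V a b c d i = 0 := by
    intro a b c d i hi
    simp only [Finset.mem_insert, Finset.mem_singleton, not_or] at hi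
    simp [V, hi]
  by_contra! hcon
  have k0 := hcon _ (hV 1 (-1) 0 1)
  have k1 := hcon _ (hV (-1) 1 (-1) 0)
  have k2 := hcon _ (hV 0 (-1) 1 (-1))
  have k3 := hcon _ (hV 1 0 (-1) 1)
  have hs : ∀ (x y : Fin 8) (a b : ℂ), Qf M (Pi.single x a) (Pi.single y b) = star a * M x y * b := by
    intro x y a b
    rw [Qf, ← Pi.single_star, Matrix.mulVec_single, single_dotProduct]
    simp [mul_assoc]
  have hsum : Qf M (V 1 (-1) 0 1) (V 1 (-1) 0 1) + Qf M (V (-1) 1 (-1) 0) (V (-1) 1 (-1) 0)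
    + Qf M (V 0 (-1) 1 (-1)) (V 0 (-1) 1 (-1)) + Qf M (V 1 0 (-1) 1) (V 1 0 (-1) 1) = ((-4/5 : ℝ) : ℂ) := by
    simp only [V, Qf_add_left, Qf_add_right, hs, h00, h11, h22, h33, h01, h10, h12, h21, h23, h32, h30, h03]
    simp only [star_one, star_neg, star_zero]
    push_cast
    ring
  have := congrArg Complex.re hsum
  rw [Complex.ofReal_re] at this
  simp only [Complex.add_re] at this
  linarith

lemma Qf_neg {n : ℕ} (M : Matrix (Fin n) (Fin n) ℂ) (u v : Fin n → ℂ) :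
    Qf (-M) u v = - Qf M u v := by simp [Qf, Matrix.neg_mulVec]

lemma lower {M : Matrix (Fin 8) (Fin 8) ℂ} (hM : M.IsHermitian)
    (h : ∀ i j : Fin 8, (i = j ∨ G₂.Adj i j) → M i j = Bad i j) : 2 ≤ negCount hM := by
  obtain ⟨u, hu, hu'⟩ := neg_vec M 0 1 2 3 (by decide)
    ((h _ _ (by decide)).trans (by simp [Bad])) ((h _ _ (by decide)).trans (by simp [Bad]))
    ((h _ _ (by decide)).trans (by simp [Bad])) ((h _ _ (by decide)).trans (by simp [Bad]))
    ((h _ _ (by decide)).trans (by simp [Bad])) ((h _ _ (by decide)).trans (by simp [Bad]))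
    ((h _ _ (by decide)).trans (by simp [Bad])) ((h _ _ (by decide)).trans (by simp [Bad]))
    ((h _ _ (by decide)).trans (by simp [Bad])) ((h _ _ (by decide)).trans (by simp [Bad]))
    ((h _ _ (by decide)).trans (by simp [Bad])) ((h _ _ (by decide)).trans (by simp [Bad]))
  obtain ⟨v, hv, hv'⟩ := neg_vec M 4 5 6 7 (by decide)
    ((h _ _ (by decide)).trans (by simp [Bad])) ((h _ _ (by decide)).trans (by simp [Bad]))
    ((h _ _ (by decide)).trans (by simp [Bad])) ((h _ _ (by decide)).trans (by simp [Bad]))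
    ((h _ _ (by decide)).trans (by simp [Bad])) ((h _ _ (by decide)).trans (by simp [Bad]))
    ((h _ _ (by decide)).trans (by simp [Bad])) ((h _ _ (by decide)).trans (by simp [Bad]))
    ((h _ _ (by decide)).trans (by simp [Bad])) ((h _ _ (by decide)).trans (by simp [Bad]))
    ((h _ _ (by decide)).trans (by simp [Bad])) ((h _ _ (by decide)).trans (by simp [Bad]))
  have huv : Qf M u v = 0 := by
    rw [Qf_eq_sum]
    refine Finset.sum_eq_zero fun i _ => Finset.sum_eq_zero fun j _ => ?_
    by_cases hi : i ∈ ({0, 1, 2, 3} : Finset (Fin 8))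
    · by_cases hj : j ∈ ({4, 5, 6, 7} : Finset (Fin 8))
      · rw [h i j (by revert i j; decide)]
        have : Bad i j = 0 := by
          simp only [Finset.mem_insert, Finset.mem_singleton] at hi hj
          rcases hi with rfl | rfl | rfl | rfl <;> rcases hj with rfl | rfl | rfl | rfl <;> simp [Bad]
        simp [this]
      · simp [hv j hj]
    · simp [hu i hi]
  obtain ⟨a1, a2⟩ := PD_add hM.neg (W := ⊥) (u := u) (by intro w hw hw0; exact absurd hw hw0)
    (by intro w hw; rw [(Submodule.mem_bot ℂ).1 hw]; simp [Qf]) (by rw [Qf_neg, Complex.neg_re]; linarith)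
  obtain ⟨b1, b2⟩ := PD_add hM.neg a1 (u := v) (by
    intro w hw
    rw [bot_sup_eq] at hw
    obtain ⟨c, rfl⟩ := Submodule.mem_span_singleton.1 hw
    rw [Qf_smul_left, Qf_neg, huv]; simp) (by rw [Qf_neg, Complex.neg_re]; linarith)
  have hb := eig_bound hM (-1) _ (fun w hw hw0 => by
    have := b1 w hw hw0
    rw [Qf_neg, Complex.neg_re] at this
    linarith)
  have hc : Fintype.card {i // 0 < -1 * hM.eigenvalues i} = negCount hM := by
    unfold negCount
    exact Fintype.card_congr (Equiv.subtypeEquivRight fun i => by simp)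
  omega

/-- The completion number of `G₂` equals `2`. -/
theorem stmt14 : CompletionNumberIs G₂ 2 := by
  refine ⟨fun A hA => upper A hA, fun k hk => ?_⟩
  obtain ⟨M, hM, h1, h2⟩ := hk Bad Bad_pp
  exact (lower hM h1).trans h2
end

section
/- For every positive integer n there exists a graph whose completion number is exactly n; hence the completion number function is surjective onto the natural numbers. -/
open Matrix ComplexOrder

lemma form_diag {m : Type*} [Fintype m] [DecidableEq m] {M : Matrix m m ℂ} (hM : M.IsHermitian)
    (x : m → ℂ) :
    (star x ⬝ᵥ (M *ᵥ x)).re =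
      ∑ i, hM.eigenvalues i * ‖((hM.eigenvectorUnitary : Matrix m m ℂ)ᴴ *ᵥ x) i‖ ^ 2 := by
  set U : Matrix m m ℂ := (hM.eigenvectorUnitary : Matrix m m ℂ) with hU
  have h1 : M = U * Matrix.diagonal (fun i => (hM.eigenvalues i : ℂ)) * Uᴴ := by
    have := hM.spectral_theorem
    rw [Unitary.conjStarAlgAut_apply] at this
    exact this
  have h2 : star x ⬝ᵥ (M *ᵥ x) =
      star (Uᴴ *ᵥ x) ⬝ᵥ (Matrix.diagonal (fun i => (hM.eigenvalues i : ℂ)) *ᵥ (Uᴴ *ᵥ x)) := by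
    conv_lhs => rw [h1]
    rw [← Matrix.mulVec_mulVec, ← Matrix.mulVec_mulVec, Matrix.dotProduct_mulVec,
      Matrix.star_mulVec, Matrix.conjTranspose_conjTranspose]
  rw [h2, dotProduct, Complex.re_sum]
  refine Finset.sum_congr rfl fun i _ => ?_
  rw [Matrix.mulVec_diagonal, Pi.star_apply]
  generalize (Uᴴ *ᵥ x) i = z
  rw [← Complex.normSq_eq_norm_sq, Complex.normSq_apply]
  simp
  ring

lemma exists_of_negCount {m : Type*} [Fintype m] [DecidableEq m] {M : Matrix m m ℂ}
    (hM : M.IsHermitian) :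
    ∃ f : (m → ℂ) →ₗ[ℂ] ({i // hM.eigenvalues i < 0} → ℂ),
      ∀ x, f x = 0 → 0 ≤ (star x ⬝ᵥ (M *ᵥ x)).re := by
  refine ⟨(LinearMap.funLeft ℂ ℂ Subtype.val).comp
    (Matrix.mulVecLin (hM.eigenvectorUnitary : Matrix m m ℂ)ᴴ), fun x hx => ?_⟩
  rw [form_diag hM]
  refine Finset.sum_nonneg fun i _ => ?_
  by_cases h : hM.eigenvalues i < 0
  · have := congrFun hx ⟨i, h⟩
    simp only [LinearMap.comp_apply, LinearMap.funLeft_apply, Matrix.mulVecLin_apply,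
      Pi.zero_apply] at this
    rw [this]; simp
  · push Not at h
    positivity

lemma negCount_le {m : Type*} [Fintype m] [DecidableEq m] {M : Matrix m m ℂ}
    (hM : M.IsHermitian) {V : Type*} [AddCommGroup V] [Module ℂ V] [FiniteDimensional ℂ V]
    (f : (m → ℂ) →ₗ[ℂ] V)
    (hf : ∀ x, f x = 0 → 0 ≤ (star x ⬝ᵥ (M *ᵥ x)).re) :
    negCount hM ≤ Module.finrank ℂ V := by
  set U : Matrix m m ℂ := (hM.eigenvectorUnitary : Matrix m m ℂ) with hU
  have hUU : Uᴴ * U = 1 := by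
    have := Unitary.coe_star_mul_self hM.eigenvectorUnitary
    exact this
  let E : ({i // hM.eigenvalues i < 0} → ℂ) →ₗ[ℂ] (m → ℂ) :=
    Function.ExtendByZero.linearMap ℂ Subtype.val
  let g := f.comp ((Matrix.mulVecLin U).comp E)
  have hg : Function.Injective g := by
    rw [injective_iff_map_eq_zero]
    intro c hc
    have h0 := hf _ hc
    rw [form_diag hM] at h0
    simp only [LinearMap.comp_apply, Matrix.mulVecLin_apply, ← hU, Matrix.mulVec_mulVec, hUU,
      Matrix.one_mulVec] at h0
    have hle : ∀ i ∈ Finset.univ, hM.eigenvalues i * ‖E c i‖ ^ 2 ≤ 0 := by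
      intro i _
      by_cases h : hM.eigenvalues i < 0
      · exact mul_nonpos_of_nonpos_of_nonneg h.le (by positivity)
      · have : E c i = 0 := by
          refine Function.extend_apply' _ _ _ ?_
          rintro ⟨a, rfl⟩
          exact h a.2
        simp [this]
    have hs := le_antisymm (Finset.sum_nonpos hle) h0
    rw [Finset.sum_eq_zero_iff_of_nonpos hle] at hs
    ext a
    have h1 := hs a.1 (Finset.mem_univ _)
    have h2 : E c a.1 = c a := Subtype.val_injective.extend_apply _ _ _
    rw [h2] at h1
    rcases mul_eq_zero.1 h1 with h | h
    · exact absurd h a.2.ne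
    · simpa using h
  have := LinearMap.finrank_le_finrank_of_injective hg
  rw [Module.finrank_fintype_fun_eq_card] at this
  exact this

/-- The set of admissible bounds. -/
def Bnd {n : ℕ} (G : SimpleGraph (Fin n)) : Set ℕ :=
  {k : ℕ | ∀ A : Matrix (Fin n) (Fin n) ℂ, IsPartialPositive G A →
    ∃ M : Matrix (Fin n) (Fin n) ℂ, ∃ hM : M.IsHermitian,
      (∀ i j : Fin n, (i = j ∨ G.Adj i j) → M i j = A i j) ∧ negCount hM ≤ k}

lemma step {m k : ℕ} (G : SimpleGraph (Fin (m + 1)))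
    (h : k ∈ Bnd (G.comap (Fin.castSucc : Fin m → Fin (m + 1)))) : k + 1 ∈ Bnd G := by
  classical
  intro A hA
  obtain ⟨⟨hA1, hA2⟩, hA3⟩ := hA
  have hA' : IsPartialPositive (G.comap (Fin.castSucc : Fin m → Fin (m + 1)))
      (A.submatrix Fin.castSucc Fin.castSucc) := by
    refine ⟨⟨fun i => hA1 _, fun i j hij => hA2 _ _ hij⟩, fun K hK => ?_⟩
    have hcl : G.IsClique ((K.map Fin.castSuccEmb : Finset (Fin (m + 1))) : Set (Fin (m + 1))) := by
      intro a ha b hb hab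
      simp only [Finset.coe_map, Set.mem_image, Finset.mem_coe] at ha hb
      obtain ⟨a, ha, rfl⟩ := ha
      obtain ⟨b, hb, rfl⟩ := hb
      exact hK ha hb (fun h => hab (by rw [h]))
    have h1 := hA3 _ hcl
    let e : K → (K.map Fin.castSuccEmb : Finset (Fin (m + 1))) :=
      fun i => ⟨Fin.castSucc i.1, Finset.mem_map.2 ⟨i.1, i.2, rfl⟩⟩
    have he : Function.Injective e := by
      intro a b hab
      have := congrArg Subtype.val hab
      exact Subtype.ext (Fin.castSucc_injective _ this)
    exact h1.submatrix he
  obtain ⟨M', hM', hE, hneg⟩ := h _ hA'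
  let M : Matrix (Fin (m + 1)) (Fin (m + 1)) ℂ := fun i j =>
    if h : i.1 < m ∧ j.1 < m then M' ⟨i, h.1⟩ ⟨j, h.2⟩ else
      if i = j ∨ G.Adj i j then A i j else 0
  have hM : M.IsHermitian := by
    ext i j
    rw [Matrix.conjTranspose_apply]
    simp only [M]
    by_cases h : i.1 < m ∧ j.1 < m
    · rw [dif_pos h, dif_pos h.symm]
      exact hM'.apply _ _
    · rw [dif_neg h, dif_neg (fun hh => h (And.symm hh))]
      by_cases hij : i = j
      · subst hij
        simp only [true_or, if_true]
        apply Complex.ext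
        · simp
        · simp [hA1 i]
      · by_cases hadj : G.Adj i j
        · rw [if_pos (Or.inr hadj.symm), if_pos (Or.inr hadj), hA2 i j hadj, star_star]
        · have : ¬ G.Adj j i := fun h => hadj h.symm
          simp [hadj, this, hij, Ne.symm hij]
  have hsub : ∀ i j : Fin m, M i.castSucc j.castSucc = M' i j := by
    intro i j
    simp [M]
  refine ⟨M, hM, ?_, ?_⟩
  · intro i j hij
    simp only [M]
    split_ifs with h
    · refine hE _ _ ?_
      rcases hij with rfl | hij
      · exact Or.inl rfl
      · exact Or.inr hij
    · rfl
  · obtain ⟨f', hf'⟩ := exists_of_negCount hM'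
    let f : (Fin (m + 1) → ℂ) →ₗ[ℂ] ({i // hM'.eigenvalues i < 0} → ℂ) × ℂ :=
      (f'.comp (LinearMap.funLeft ℂ ℂ Fin.castSucc)).prod (LinearMap.proj (Fin.last m))
    have := negCount_le hM f (fun x hx => by
      have hx1 : f' (LinearMap.funLeft ℂ ℂ Fin.castSucc x) = 0 := congrArg Prod.fst hx
      have hx2 : x (Fin.last m) = 0 := congrArg Prod.snd hx
      have := hf' _ hx1
      convert this using 2
      simp only [dotProduct, Matrix.mulVec, Fin.sum_univ_castSucc, hx2, hsub, Pi.star_apply,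
        LinearMap.funLeft_apply]
      simp)
    refine this.trans ?_
    rw [Module.finrank_prod, Module.finrank_fintype_fun_eq_card, Module.finrank_self]
    exact Nat.add_le_add_right hneg 1

/-- The 4×4 seed. -/
noncomputable def seed : Matrix (Fin 4) (Fin 4) ℂ :=
  !![5/4, 1, 0, -1; 1, 5/4, 1, 0; 0, 1, 5/4, 1; -1, 0, 1, 5/4]

/-- The blow-up of the 4-cycle. -/
def blow (N : ℕ) : SimpleGraph (Fin (4 * N)) where
  Adj i j := i ≠ j ∧ (finProdFinEquiv.symm i).1 ≠ (finProdFinEquiv.symm j).1 + 2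
  symm := ⟨by
    rintro i j ⟨h1, h2⟩
    refine ⟨h1.symm, ?_⟩
    revert h2
    generalize (finProdFinEquiv.symm i).1 = a
    generalize (finProdFinEquiv.symm j).1 = b
    revert a b
    decide⟩
  loopless := ⟨fun i h => h.1 rfl⟩

/-- The blown-up data. -/
noncomputable def bigA (N : ℕ) : Matrix (Fin (4 * N)) (Fin (4 * N)) ℂ := fun i j =>
  if (finProdFinEquiv.symm i).2 = (finProdFinEquiv.symm j).2 then
    seed (finProdFinEquiv.symm i).1 (finProdFinEquiv.symm j).1 else 0

lemma seed_symm (a b : Fin 4) : seed b a = star (seed a b) := by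
  fin_cases a <;> fin_cases b <;> simp [seed]

lemma seed_pos (z : Fin 4 → ℂ) (h02 : z 0 = 0 ∨ z 2 = 0) (h13 : z 1 = 0 ∨ z 3 = 0) :
    (1 / 4) * ∑ a, ‖z a‖ ^ 2 ≤ (∑ a, ∑ b, star (z a) * (seed a b * z b)).re := by
  simp only [← Complex.normSq_eq_norm_sq, Complex.normSq_apply, Fin.sum_univ_four, seed]
  rcases h02 with h | h <;> rcases h13 with h' | h' <;> simp [h, h']
  · nlinarith [sq_nonneg ((z 2).re + (z 3).re), sq_nonneg ((z 2).im + (z 3).im)]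
  · nlinarith [sq_nonneg ((z 2).re + (z 1).re), sq_nonneg ((z 2).im + (z 1).im)]
  · nlinarith [sq_nonneg ((z 0).re - (z 3).re), sq_nonneg ((z 0).im - (z 3).im)]
  · nlinarith [sq_nonneg ((z 0).re + (z 1).re), sq_nonneg ((z 0).im + (z 1).im)]

lemma bigA_form (N : ℕ) (y : Fin (4 * N) → ℂ) :
    star y ⬝ᵥ (bigA N *ᵥ y) = ∑ j : Fin N, ∑ a, ∑ b,
      star (y (finProdFinEquiv (a, j))) * (seed a b * y (finProdFinEquiv (b, j))) := by
  simp only [dotProduct, Matrix.mulVec, Finset.mul_sum]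
  rw [← finProdFinEquiv.sum_comp, Fintype.sum_prod_type, Finset.sum_comm]
  refine Finset.sum_congr rfl fun j _ => Finset.sum_congr rfl fun a _ => ?_
  rw [← finProdFinEquiv.sum_comp, Fintype.sum_prod_type]
  refine Finset.sum_congr rfl fun b _ => ?_
  simp [bigA]

lemma bigA_herm (N : ℕ) : (bigA N).IsHermitian := by
  ext i j
  simp only [Matrix.conjTranspose_apply, bigA]
  by_cases h : (finProdFinEquiv.symm i).2 = (finProdFinEquiv.symm j).2
  · rw [if_pos h, if_pos h.symm, ← seed_symm]
  · rw [if_neg h, if_neg (Ne.symm h), star_zero]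

lemma bigA_pos (N : ℕ) : IsPartialPositive (blow N) (bigA N) := by
  classical
  refine ⟨⟨fun i => ?_, fun i j _ => ((bigA_herm N).apply _ _).symm⟩, fun K hK => ?_⟩
  · have := (bigA_herm N).apply i i
    exact Complex.conj_eq_iff_im.1 this
  · have hH : (cliqueSub (bigA N) K).IsHermitian := (bigA_herm N).submatrix _
    refine Matrix.PosDef.of_dotProduct_mulVec_pos hH fun x hx => ?_
    let y : Fin (4 * N) → ℂ := fun i => if h : i ∈ K then x ⟨i, h⟩ else 0
    have hyK : ∀ i : K, y i = x i := fun i => by simp [y]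
    have hy0 : ∀ i, i ∉ K → y i = 0 := fun i h => by simp [y, h]
    have hsum : ∀ g : Fin (4 * N) → ℂ, (∀ i, i ∉ K → g i = 0) → ∑ i : K, g i = ∑ i, g i := by
      intro g hg
      rw [Finset.sum_coe_sort K g]
      exact Finset.sum_subset (Finset.subset_univ _) (fun i _ h => hg i h)
    have hform : star x ⬝ᵥ (cliqueSub (bigA N) K *ᵥ x) = star y ⬝ᵥ (bigA N *ᵥ y) := by
      simp only [dotProduct, Matrix.mulVec, cliqueSub, Matrix.submatrix_apply, Pi.star_apply]
      rw [← hsum _ (fun i h => by simp [hy0 i h])]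
      refine Finset.sum_congr rfl fun i _ => ?_
      rw [hyK, ← hsum _ (fun i h => by simp [hy0 i h])]
      congr 1
      exact Finset.sum_congr rfl fun j _ => by rw [hyK]
    have hre : 0 < (star x ⬝ᵥ (cliqueSub (bigA N) K *ᵥ x)).re := by
      rw [hform, bigA_form, Complex.re_sum]
      have hopp : ∀ (j : Fin N) (a b : Fin 4), a ≠ b → a = b + 2 →
          y (finProdFinEquiv (a, j)) = 0 ∨ y (finProdFinEquiv (b, j)) = 0 := by
        intro j a b hab hab2
        by_contra! hcon
        have h1 : finProdFinEquiv (a, j) ∈ K := by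
          by_contra h; exact hcon.1 (hy0 _ h)
        have h2 : finProdFinEquiv (b, j) ∈ K := by
          by_contra h; exact hcon.2 (hy0 _ h)
        have := hK h1 h2 (fun h => hab (by simpa using h))
        exact this.2 (by simpa using hab2)
      have hle : ∀ j : Fin N, (1 / 4) * ∑ a, ‖y (finProdFinEquiv (a, j))‖ ^ 2 ≤
          (∑ a, ∑ b, star (y (finProdFinEquiv (a, j))) *
            (seed a b * y (finProdFinEquiv (b, j)))).re := fun j =>
        seed_pos (fun a => y (finProdFinEquiv (a, j))) (hopp j 0 2 (by decide) (by decide))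
          (hopp j 1 3 (by decide) (by decide))
      refine lt_of_lt_of_le ?_ (Finset.sum_le_sum fun j _ => hle j)
      obtain ⟨i, hi⟩ := Function.ne_iff.1 hx
      obtain ⟨⟨a, j⟩, hp⟩ := finProdFinEquiv.surjective i.1
      have hyi : y (finProdFinEquiv (a, j)) ≠ 0 := by rw [hp, hyK]; exact hi
      refine Finset.sum_pos' (fun j _ => by positivity) ⟨j, Finset.mem_univ _, ?_⟩
      refine mul_pos (by norm_num) (Finset.sum_pos' (fun j _ => by positivity)
        ⟨a, Finset.mem_univ _, ?_⟩)
      positivity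
    rw [Complex.pos_iff]
    refine ⟨hre, ?_⟩
    have := hH.im_star_dotProduct_mulVec_self x
    exact this.symm

/-- embedding `v ↦ t ⊗ v`. -/
noncomputable def tens (N : ℕ) (t : Fin 4 → ℂ) : (Fin N → ℂ) →ₗ[ℂ] (Fin (4 * N) → ℂ) where
  toFun v i := t (finProdFinEquiv.symm i).1 * v (finProdFinEquiv.symm i).2
  map_add' v w := by ext i; simp [mul_add]
  map_smul' c v := by ext i; simp; ring

lemma tens_form (N : ℕ) (M : Matrix (Fin (4 * N)) (Fin (4 * N)) ℂ) (t : Fin 4 → ℂ)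
    (v : Fin N → ℂ) :
    star (tens N t v) ⬝ᵥ (M *ᵥ (tens N t v)) = ∑ a, ∑ b, star (t a) * t b *
      (∑ i, ∑ j, star (v i) * M (finProdFinEquiv (a, i)) (finProdFinEquiv (b, j)) * v j) := by
  simp only [dotProduct, Matrix.mulVec, Finset.mul_sum]
  rw [← finProdFinEquiv.sum_comp, Fintype.sum_prod_type]
  refine Finset.sum_congr rfl fun a _ => ?_
  rw [Finset.sum_comm]
  rw [← finProdFinEquiv.sum_comp, Fintype.sum_prod_type]
  refine Finset.sum_congr rfl fun b _ => ?_
  rw [Finset.sum_comm]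
  refine Finset.sum_congr rfl fun i _ => Finset.sum_congr rfl fun j _ => ?_
  have ht : ∀ (c : Fin 4) (l : Fin N), tens N t v (finProdFinEquiv (c, l)) = t c * v l := by
    intro c l
    change t (finProdFinEquiv.symm (finProdFinEquiv (c, l))).1 *
      v (finProdFinEquiv.symm (finProdFinEquiv (c, l))).2 = _
    rw [Equiv.symm_apply_apply]
  rw [Pi.star_apply, ht, ht, star_mul']
  ring

lemma blow_lower (N k : ℕ) (hk : 2 * k < N) : k ∉ Bnd (blow N) := by
  intro h
  obtain ⟨M, hM, hE, hneg⟩ := h _ (bigA_pos N)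
  obtain ⟨f, hf⟩ := exists_of_negCount hM
  let g := (f.comp (tens N ![1, -1, 1, 0])).prod (f.comp (tens N ![1, 0, -1, 1]))
  have hker : LinearMap.ker g ≠ ⊥ := by
    apply LinearMap.ker_ne_bot_of_finrank_lt
    rw [Module.finrank_prod, Module.finrank_fintype_fun_eq_card,
      Module.finrank_fintype_fun_eq_card, Fintype.card_fin]
    have : Fintype.card {i // hM.eigenvalues i < 0} ≤ k := hneg
    omega
  obtain ⟨v, hv, hv0⟩ := Submodule.exists_mem_ne_zero_of_ne_bot hker
  have h1 := hf _ (congrArg Prod.fst hv)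
  have h2 := hf _ (congrArg Prod.snd hv)
  rw [tens_form] at h1 h2
  set B : Fin 4 → Fin 4 → ℂ := fun a b =>
    ∑ i, ∑ j, star (v i) * M (finProdFinEquiv (a, i)) (finProdFinEquiv (b, j)) * v j with hB
  have hBval : ∀ a b : Fin 4, a ≠ b + 2 → B a b = seed a b * ((∑ i, ‖v i‖ ^ 2 : ℝ) : ℂ) := by
    intro a b hab
    have hM2 : ∀ i j, M (finProdFinEquiv (a, i)) (finProdFinEquiv (b, j)) =
        if i = j then seed a b else 0 := by
      intro i j
      rw [hE]
      · simp [bigA]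
      · by_cases hh : finProdFinEquiv (a, i) = finProdFinEquiv (b, j)
        · exact Or.inl hh
        · exact Or.inr ⟨hh, by simpa using hab⟩
    simp only [hB, hM2]
    simp only [mul_ite, ite_mul, mul_zero, zero_mul, Finset.sum_ite_eq, Finset.mem_univ, if_true]
    push_cast
    rw [Finset.mul_sum]
    refine Finset.sum_congr rfl fun i _ => ?_
    rw [← Complex.conj_mul']
    simp
    ring
  have hS : 0 < ∑ i, ‖v i‖ ^ 2 := by
    obtain ⟨i, hi⟩ := Function.ne_iff.1 hv0
    refine Finset.sum_pos' (fun j _ => by positivity) ⟨i, Finset.mem_univ _, ?_⟩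
    have : v i ≠ 0 := hi
    positivity
  change 0 ≤ (∑ a, ∑ b, star ((![1, -1, 1, 0] : Fin 4 → ℂ) a) * (![1, -1, 1, 0] : Fin 4 → ℂ) b *
    B a b).re at h1
  change 0 ≤ (∑ a, ∑ b, star ((![1, 0, -1, 1] : Fin 4 → ℂ) a) * (![1, 0, -1, 1] : Fin 4 → ℂ) b *
    B a b).re at h2
  generalize (∑ i, ‖v i‖ ^ 2) = S at hBval hS
  clear_value B
  simp only [Fin.sum_univ_four] at h1 h2
  rw [hBval 0 0 (by decide), hBval 0 1 (by decide), hBval 1 0 (by decide),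
    hBval 1 1 (by decide), hBval 1 2 (by decide), hBval 2 1 (by decide),
    hBval 2 2 (by decide)] at h1
  rw [hBval 0 0 (by decide), hBval 0 3 (by decide), hBval 3 0 (by decide),
    hBval 3 3 (by decide), hBval 3 2 (by decide), hBval 2 3 (by decide),
    hBval 2 2 (by decide)] at h2
  simp [seed] at h1 h2
  linarith

/-- Every natural number is the completion number of some graph. -/
theorem stmt16 (n : ℕ) :
    ∃ m : ℕ, ∃ G : SimpleGraph (Fin m), CompletionNumberIs G n := by
  classical
  have hex : ∃ m : ℕ, ∃ G : SimpleGraph (Fin m), n ∈ lowerBounds (Bnd G) := by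
    refine ⟨_, blow (2 * n + 1), fun k hk => ?_⟩
    by_contra hlt
    exact blow_lower (2 * n + 1) k (by omega) hk
  obtain ⟨G, hG⟩ := Nat.find_spec hex
  have hmin := fun m' => Nat.find_min hex (m := m')
  generalize Nat.find hex = m at G hG hmin
  refine ⟨m, G, ?_, hG⟩
  change n ∈ Bnd G
  cases m with
  | zero =>
    have h0 : 0 ∈ Bnd G := by
      intro A _
      refine ⟨A, by ext i; exact i.elim0, fun i => i.elim0, ?_⟩
      unfold negCount
      rw [Nat.le_zero, Fintype.card_eq_zero_iff]
      exact ⟨fun i => i.1.elim0⟩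
    have : n = 0 := Nat.le_zero.1 (hG h0)
    rwa [this]
  | succ m =>
    have h1 := hmin m (Nat.lt_succ_self m)
    push Not at h1
    have h2 := h1 (G.comap Fin.castSucc)
    simp only [lowerBounds, Set.mem_setOf_eq, not_forall] at h2
    obtain ⟨k, hk, hkn⟩ := h2
    have h3 := step G hk
    have h4 := hG h3
    have : n = k + 1 := by omega
    rwa [this]
end
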